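/- Let n ≥ 2 and let E = E(r_1,…,r_n) ⊂ ℝ^{2n} be the open ellipsoid with half axes 1 = r_1 ≤ … ≤ r_n = R. Let ε ∈ (0,1), set U_ε = (1+ε)E \ closure((1−ε)E), let r > 0, and let φ be a symplectic embedding of an open neighborhood of S_r^{2n−1} into U_ε. If the bounded connected component D of ℝ^{2n} \ φ(S_r^{2n−1}) is contained in U_ε, then πr² < ((1+ε)^{2n} − (1−ε)^{2n})^{1/n} · πR². -/

import Mathlib

open Metric Set MeasureTheory Real Filter Topology Bornology
open scoped ContDiff ENNReal

noncomputable section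

/-- `ℝ^{2n}` with the Euclidean structure. -/
abbrev R2n (n : ℕ) := EuclideanSpace ℝ (Fin (2 * n))

/-- The standard symplectic form `ω_st = Σ dx_i ∧ dy_i` on `ℝ^{2n}`,
evaluated on a pair of (tangent) vectors. -/
def sympForm (n : ℕ) (v w : R2n n) : ℝ :=
  ∑ i : Fin n,
    (v ⟨2 * i.1, by have := i.isLt; omega⟩ * w ⟨2 * i.1 + 1, by have := i.isLt; omega⟩ -
      v ⟨2 * i.1 + 1, by have := i.isLt; omega⟩ * w ⟨2 * i.1, by have := i.isLt; omega⟩)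

/-- `φ` is a symplectic embedding of the open set `N ⊆ ℝ^{2n}` into `U ⊆ ℝ^{2n}`:
a smooth injective map on `N` with image in `U` whose derivative preserves `ω_st`. -/
def IsSympEmbOn (n : ℕ) (N U : Set (R2n n)) (φ : R2n n → R2n n) : Prop :=
  IsOpen N ∧ ContDiffOn ℝ ∞ φ N ∧ InjOn φ N ∧ MapsTo φ N U ∧
    ∀ p ∈ N, ∀ v w : R2n n,
      sympForm n (fderiv ℝ φ p v) (fderiv ℝ φ p w) = sympForm n v w

/-- A symplectic embedding of (a neighbourhood of) an arbitrary set `A ⊆ ℝ^{2n}` into `U`. -/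
def SympEmbNbhd (n : ℕ) (A U : Set (R2n n)) : Prop :=
  ∃ N φ, A ⊆ N ∧ IsSympEmbOn n N U φ

/-- The spherical capacity `s(U)`. -/
def sphericalCap (n : ℕ) (U : Set (R2n n)) : ℝ≥0∞ :=
  sSup {c : ℝ≥0∞ | ∃ r : ℝ, 0 < r ∧ c = ENNReal.ofReal (π * r ^ 2) ∧
    SympEmbNbhd n (sphere (0 : R2n n) r) U}

/-- The quadratic form defining the ellipsoid with symplectic half axes `a i`. -/
def ellQ (n : ℕ) (a : Fin n → ℝ) (z : R2n n) : ℝ :=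
  ∑ i : Fin n,
    ((z ⟨2 * i.1, by have := i.isLt; omega⟩) ^ 2 +
      (z ⟨2 * i.1 + 1, by have := i.isLt; omega⟩) ^ 2) / (a i) ^ 2

/-- The open ellipsoid `E(a 0, …, a (n-1)) ⊆ ℝ^{2n}`. -/
def ellipsoid (n : ℕ) (a : Fin n → ℝ) : Set (R2n n) := {z | ellQ n a z < 1}

/-- The boundary `∂E(a 0, …, a (n-1)) ⊆ ℝ^{2n}` of an ellipsoid. -/
def ellipsoidBdry (n : ℕ) (a : Fin n → ℝ) : Set (R2n n) := {z | ellQ n a z = 1}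

/-- The ellipsoidal shell `U_ε = (1+ε)E \ closure((1-ε)E)`. -/
def ellShell (n : ℕ) (a : Fin n → ℝ) (ε : ℝ) : Set (R2n n) :=
  ellipsoid n (fun i => (1 + ε) * a i) \ closure (ellipsoid n (fun i => (1 - ε) * a i))

/-- The `δ`-shell capacity `c_δ(U)`, defined via embeddings of the closed
shells `r A_δ = closure(B_r) \ B_{r(1-δ)}`. -/
def shellCap (n : ℕ) (δ : ℝ) (U : Set (R2n n)) : ℝ≥0∞ :=
  sSup {c : ℝ≥0∞ | ∃ r : ℝ, 0 < r ∧ c = ENNReal.ofReal (π * r ^ 2) ∧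
    SympEmbNbhd n (closedBall (0 : R2n n) r \ ball 0 (r * (1 - δ))) U}

/-- The ellipsoidal capacity `e(U)`: the supremum of `π r₁²` over symplectic embeddings of
boundaries of ellipsoids with half axes `r₁ ≤ … ≤ r_n` (here `r₁ = ⨅ i, a i`). -/
def ellipsoidalCap (n : ℕ) (U : Set (R2n n)) : ℝ≥0∞ :=
  sSup {c : ℝ≥0∞ | ∃ a : Fin n → ℝ, (∀ i, 0 < a i) ∧ Monotone a ∧
    c = ENNReal.ofReal (π * (⨅ i, a i) ^ 2) ∧ SympEmbNbhd n (ellipsoidBdry n a) U}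

/-- The Gromov radius `c_B(U)`. -/
def gromovRadius (n : ℕ) (U : Set (R2n n)) : ℝ≥0∞ :=
  sSup {c : ℝ≥0∞ | ∃ r : ℝ, 0 < r ∧ c = ENNReal.ofReal (π * r ^ 2) ∧
    ∃ φ, IsSympEmbOn n (ball (0 : R2n n) r) U φ}

open scoped RealInnerProductSpace

section Hermitian

variable {V : Type*} [NormedAddCommGroup V] [InnerProductSpace ℝ V]

/-- `J` is an orthogonal complex structure; the associated symplectic form is
`(v, w) ↦ ⟪J v, w⟫`. -/
structure IsOrthoComplexStructure (J : V →L[ℝ] V) : Prop where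
  sq : ∀ v, J (J v) = -v
  inner_map : ∀ v w, ⟪J v, J w⟫ = ⟪v, w⟫

namespace IsOrthoComplexStructure

variable {J : V →L[ℝ] V}

theorem inner_left (hJ : IsOrthoComplexStructure J) (v w : V) : ⟪J v, w⟫ = -⟪v, J w⟫ := by
  have h := hJ.inner_map v (J w)
  rw [hJ.sq, inner_neg_right] at h
  linarith

theorem inner_left_swap (hJ : IsOrthoComplexStructure J) (v w : V) : ⟪J v, w⟫ = -⟪J w, v⟫ := by
  rw [hJ.inner_left, real_inner_comm]

theorem inner_self (hJ : IsOrthoComplexStructure J) (v : V) : ⟪J v, v⟫ = 0 := by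
  have h := hJ.inner_left_swap v v
  linarith

theorem norm_map (hJ : IsOrthoComplexStructure J) (v : V) : ‖J v‖ = ‖v‖ := by
  have h := hJ.inner_map v v
  rw [real_inner_self_eq_norm_sq, real_inner_self_eq_norm_sq] at h
  exact (sq_eq_sq₀ (norm_nonneg _) (norm_nonneg _)).1 h

theorem injective_of_symplectic (hJ : IsOrthoComplexStructure J)
    {A : V →L[ℝ] V}
    (hA : ∀ v w, ⟪J (A v), A w⟫ = ⟪J v, w⟫) : Function.Injective A := by
  refine (injective_iff_map_eq_zero A).2 fun v hv => ?_
  have h := hA v (J v)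
  rw [hv, map_zero, inner_zero_left, real_inner_self_eq_norm_sq, hJ.norm_map] at h
  exact norm_eq_zero.1 (pow_eq_zero_iff two_ne_zero |>.1 h.symm)

theorem abs_det_of_symplectic (hJ : IsOrthoComplexStructure J)
    [FiniteDimensional ℝ V] {A : V →L[ℝ] V}
    (hA : ∀ v w, ⟪J (A v), A w⟫ = ⟪J v, w⟫) : |A.det| = 1 := by
  have hcomp : LinearMap.adjoint (A : V →ₗ[ℝ] V) ∘ₗ (J : V →ₗ[ℝ] V) ∘ₗ (A : V →ₗ[ℝ] V)
      = (J : V →ₗ[ℝ] V) := by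
    ext v
    refine ext_inner_right ℝ fun w => ?_
    simpa [LinearMap.adjoint_inner_left] using hA v w
  have hadj : LinearMap.det (LinearMap.adjoint (A : V →ₗ[ℝ] V)) =
      LinearMap.det (A : V →ₗ[ℝ] V) := by
    rw [← LinearMap.det_toMatrix (stdOrthonormalBasis ℝ V).toBasis,
      LinearMap.toMatrix_adjoint, Matrix.det_conjTranspose,
      LinearMap.det_toMatrix, star_trivial]
  have hJdet : LinearMap.det (J : V →ₗ[ℝ] V) ≠ 0 := by
    have hneg : (J : V →ₗ[ℝ] V) ∘ₗ (-(J : V →ₗ[ℝ] V)) = LinearMap.id := by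
      ext v
      simp [hJ.sq]
    have h := congrArg LinearMap.det hneg
    rw [LinearMap.det_comp, LinearMap.det_id] at h
    exact left_ne_zero_of_mul_eq_one h
  have h := congrArg LinearMap.det hcomp
  rw [LinearMap.det_comp, LinearMap.det_comp, hadj] at h
  have h1 : A.det * A.det = 1 := by
    apply mul_left_cancel₀ hJdet
    change LinearMap.det (J : V →ₗ[ℝ] V) * (LinearMap.det (A : V →ₗ[ℝ] V) * LinearMap.det (A : V →ₗ[ℝ] V)) = _
    linear_combination h
  rcases mul_self_eq_one_iff.1 h1 with h | h <;> simp [h]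

/-- Rotation by the angle `t` in the complex lines of `J`. -/
def rotation (hJ : IsOrthoComplexStructure J)
    [FiniteDimensional ℝ V] (t : ℝ) : V ≃ₗᵢ[ℝ] V :=
  LinearIsometry.toLinearIsometryEquiv
    { toLinearMap := cos t • LinearMap.id + sin t • (J : V →ₗ[ℝ] V)
      norm_map' := fun v => by
        refine (sq_eq_sq₀ (norm_nonneg _) (norm_nonneg _)).1 ?_
        have h : ⟪v, J v⟫ = 0 := by rw [real_inner_comm]; exact hJ.inner_self v
        simp only [LinearMap.add_apply, LinearMap.smul_apply, LinearMap.id_apply,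
          ContinuousLinearMap.coe_coe]
        rw [norm_add_sq_real, inner_smul_left, inner_smul_right, h, norm_smul, norm_smul,
          hJ.norm_map, mul_pow, mul_pow, norm_eq_abs, norm_eq_abs, sq_abs, sq_abs]
        linear_combination ‖v‖ ^ 2 * sin_sq_add_cos_sq t } rfl

theorem rotation_apply (hJ : IsOrthoComplexStructure J)
    [FiniteDimensional ℝ V] (t : ℝ) (v : V) :
    hJ.rotation t v = cos t • v + sin t • J v := rfl

theorem hasDerivAt_rotation (hJ : IsOrthoComplexStructure J)
    [FiniteDimensional ℝ V] (t : ℝ) (v : V) :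
    HasDerivAt (fun s => hJ.rotation s v) (J (hJ.rotation t v)) t := by
  simp only [rotation_apply, map_add, map_smul, hJ.sq, smul_neg]
  refine (((hasDerivAt_cos t).smul_const v).fun_add
    ((hasDerivAt_sin t).smul_const (J v))).congr_deriv ?_
  module

end IsOrthoComplexStructure

end Hermitian

section Action

variable {V : Type*} [NormedAddCommGroup V] [InnerProductSpace ℝ V]

/-- Stokes' theorem for the pull-back of the primitive `⟪J u, du⟫` of (twice) the symplectic form
along a map `u` of the rectangle `[0, b] × [0, c]` that is constant on the side `{b} × [0, c]` and
takes equal values on the sides `[0, b] × {0}` and `[0, b] × {c}`. -/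
theorem IsOrthoComplexStructure.integral_action_eq {J : V →L[ℝ] V}
    (hJ : IsOrthoComplexStructure J) {u : ℝ × ℝ → V} (hu : ContDiff ℝ 2 u) {b c : ℝ}
    (hper : ∀ θ, u (θ, 0) = u (θ, c)) (hconst : ∀ t, u (b, t) = u (b, 0)) :
    ∫ t in (0 : ℝ)..c, ⟪J (u (0, t)), fderiv ℝ u (0, t) (0, 1)⟫ =
      -∫ θ in (0 : ℝ)..b, ∫ t in (0 : ℝ)..c,
        2 * ⟪J (fderiv ℝ u (θ, t) (1, 0)), fderiv ℝ u (θ, t) (0, 1)⟫ := by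
  have hdu : Differentiable ℝ u := hu.differentiable (by norm_num)
  have hd : ContDiff ℝ 1 (fderiv ℝ u) := hu.fderiv_right (by norm_num)
  have hdd : Differentiable ℝ (fderiv ℝ u) := hd.differentiable (by norm_num)
  have hJu : ∀ p, HasFDerivAt (fun p => J (u p)) (J ∘L fderiv ℝ u p) p := fun p =>
    J.hasFDerivAt.comp p (hdu p).hasFDerivAt
  have hdv : ∀ (e : ℝ × ℝ) p, HasFDerivAt (fun p => fderiv ℝ u p e)
      ((ContinuousLinearMap.apply ℝ V e) ∘L fderiv ℝ (fderiv ℝ u) p) p := fun e p =>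
    (ContinuousLinearMap.apply ℝ V e).hasFDerivAt.comp p (hdd p).hasFDerivAt
  have hF := fun (e : ℝ × ℝ) p => (hJu p).inner ℝ (hdv e p)
  have hsymm : ∀ p v w, fderiv ℝ (fderiv ℝ u) p v w = fderiv ℝ (fderiv ℝ u) p w v :=
    fun p v w => (hu.contDiffAt.isSymmSndFDerivAt (by simp)).eq v w
  have hcont : ∀ e : ℝ × ℝ, Continuous fun p => fderiv ℝ u p e := fun e =>
    hd.continuous.clm_apply continuous_const
  have h_integrable : ∀ p : ℝ × ℝ,
      ((fderivInnerCLM ℝ (J (u p), fderiv ℝ u p (0, 1))).comp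
        ((J ∘L fderiv ℝ u p).prod
          (ContinuousLinearMap.apply ℝ V (0, 1) ∘L fderiv ℝ (fderiv ℝ u) p))) (1, 0) +
      (-((fderivInnerCLM ℝ (J (u p), fderiv ℝ u p (1, 0))).comp
        ((J ∘L fderiv ℝ u p).prod
          (ContinuousLinearMap.apply ℝ V (1, 0) ∘L fderiv ℝ (fderiv ℝ u) p)))) (0, 1) =
      2 * ⟪J (fderiv ℝ u p (1, 0)), fderiv ℝ u p (0, 1)⟫ := by
    intro p
    simp only [ContinuousLinearMap.comp_apply, neg_apply,
      ContinuousLinearMap.prod_apply, fderivInnerCLM_apply, ContinuousLinearMap.apply_apply]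
    rw [hsymm p (0, 1) (1, 0), hJ.inner_left_swap (fderiv ℝ u p (0, 1))]
    ring
  have hkey := integral2_divergence_prod_of_hasFDerivAt
    (fun p => ⟪J (u p), fderiv ℝ u p (0, 1)⟫) (fun p => -⟪J (u p), fderiv ℝ u p (1, 0)⟫)
    _ _ 0 0 b c
    (fun p _ => (hF (0, 1) p).continuousAt.continuousWithinAt)
    (fun p _ => (hF (1, 0) p).neg.continuousAt.continuousWithinAt)
    (fun p _ => hF (0, 1) p) (fun p _ => (hF (1, 0) p).neg) ?_
  · simp only [h_integrable] at hkey
    have hper' : ∀ θ, fderiv ℝ u (θ, c) (1, 0) = fderiv ℝ u (θ, 0) (1, 0) := by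
      have hderiv : ∀ t θ, HasDerivAt (fun θ => u (θ, t)) (fderiv ℝ u (θ, t) (1, 0)) θ :=
        fun t θ => (hdu (θ, t)).hasFDerivAt.comp_hasDerivAt θ
          ((hasDerivAt_id θ).prodMk (hasDerivAt_const θ t))
      intro θ
      have h0 := hderiv 0 θ
      simp only [hper] at h0
      exact (hderiv c θ).unique h0
    have hconst' : ∀ t, fderiv ℝ u (b, t) (0, 1) = 0 := by
      intro t
      have h := (hdu (b, t)).hasFDerivAt.comp_hasDerivAt t
        ((hasDerivAt_const t b).prodMk (hasDerivAt_id t))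
      have h0 : (u ∘ Prod.mk b) = fun _ => u (b, 0) := funext fun s => hconst s
      rw [h0] at h
      exact h.unique (hasDerivAt_const t _)
    simp only [hper', hconst', inner_zero_right, intervalIntegral.integral_zero, ← hper,
      sub_self, zero_add] at hkey
    rw [hkey]
    simp
  · simp only [h_integrable]
    refine ContinuousOn.integrableOn_compact (isCompact_uIcc.prod isCompact_uIcc)
      (Continuous.continuousOn ?_)
    exact continuous_const.mul ((J.continuous.comp (hcont _)).inner (hcont _))

end Action

section RotationAction

variable {V : Type*} [NormedAddCommGroup V] [InnerProductSpace ℝ V] [FiniteDimensional ℝ V]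

theorem exists_norm_eq_one_orthogonal_pair (h : 2 < Module.finrank ℝ V) (x y : V) :
    ∃ w : V, ‖w‖ = 1 ∧ ⟪x, w⟫ = 0 ∧ ⟪y, w⟫ = 0 := by
  classical
  let K : Submodule ℝ V := Submodule.span ℝ {x, y}
  have hK : Module.finrank ℝ K ≤ 2 := by
    have h1 := finrank_span_finset_le_card (R := ℝ) ({x, y} : Finset V)
    simp only [Finset.coe_insert, Finset.coe_singleton] at h1
    exact h1.trans Finset.card_le_two
  have hpos : 0 < Module.finrank ℝ Kᗮ := by
    have := K.finrank_add_finrank_orthogonal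
    omega
  have := Module.finrank_pos_iff.1 hpos
  obtain ⟨w, hw⟩ := exists_norm_eq Kᗮ zero_le_one
  refine ⟨w, hw, ?_, ?_⟩ <;>
  exact (Submodule.mem_orthogonal K w).1 w.2 _ (Submodule.subset_span (by simp))

/-- The circles generated by a complex structure on a sphere of dimension at least three have the
same action before and after a symplectic embedding of a neighbourhood of that sphere, since they
are contractible in the sphere. -/
theorem IsOrthoComplexStructure.integral_rotation_action {J : V →L[ℝ] V}
    (hJ : IsOrthoComplexStructure J) (hdim : 2 < Module.finrank ℝ V) {N : Set V} (hN : IsOpen N)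
    {φ : V → V} (hφ : ContDiffOn ℝ ∞ φ N)
    (hsymp : ∀ p ∈ N, ∀ v w, ⟪J (fderiv ℝ φ p v), fderiv ℝ φ p w⟫ = ⟪J v, w⟫)
    {x : V} (hx : sphere (0 : V) ‖x‖ ⊆ N) :
    ∫ t in (0 : ℝ)..(2 * π), ⟪J (φ (hJ.rotation t x)),
      fderiv ℝ φ (hJ.rotation t x) (J (hJ.rotation t x))⟫ = 2 * π * ‖x‖ ^ 2 := by
  obtain ⟨e, he, hxe, hJxe⟩ := exists_norm_eq_one_orthogonal_pair hdim x (J x)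
  let w : V := ‖x‖ • e
  let γ : ℝ × ℝ → V := fun p => cos p.1 • (cos p.2 • x + sin p.2 • J x) + sin p.1 • w
  have hγ : ContDiff ℝ 2 γ := by
    refine ContDiff.add (ContDiff.smul (contDiff_cos.comp contDiff_fst) (ContDiff.add ?_ ?_)) ?_
    · exact (contDiff_cos.comp contDiff_snd).smul contDiff_const
    · exact (contDiff_sin.comp contDiff_snd).smul contDiff_const
    · exact (contDiff_sin.comp contDiff_fst).smul contDiff_const
  have hγ_rot : ∀ θ t, γ (θ, t) = cos θ • hJ.rotation t x + sin θ • w := fun _ _ => rfl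
  have hγN : ∀ p, γ p ∈ N := by
    rintro ⟨θ, t⟩
    refine hx (mem_sphere_zero_iff_norm.2 ?_)
    refine (sq_eq_sq₀ (norm_nonneg _) (norm_nonneg _)).1 ?_
    have horth : ⟪hJ.rotation t x, e⟫ = 0 := by
      rw [hJ.rotation_apply, inner_add_left, inner_smul_left, inner_smul_left, hxe, hJxe]
      simp
    rw [hγ_rot, norm_add_sq_real, inner_smul_left, inner_smul_right, inner_smul_right, horth,
      norm_smul, norm_smul, norm_smul, he, LinearIsometryEquiv.norm_map, norm_norm, mul_pow,
      mul_pow, norm_eq_abs, norm_eq_abs, sq_abs, sq_abs]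
    linear_combination ‖x‖ ^ 2 * sin_sq_add_cos_sq θ
  have hφγ : ContDiff ℝ 2 (φ ∘ γ) := contDiff_iff_contDiffAt.2 fun p =>
    ((hφ.contDiffAt (hN.mem_nhds (hγN p))).of_le (WithTop.coe_le_coe.2 (le_top (a := (2 : ℕ∞))))).comp p
      hγ.contDiffAt
  have hper : ∀ θ, γ (θ, 0) = γ (θ, 2 * π) := fun θ => by simp [γ]
  have hconst : ∀ t, γ (π / 2, t) = γ (π / 2, 0) := fun t => by simp [γ]
  have hfd : ∀ p, fderiv ℝ (φ ∘ γ) p = (fderiv ℝ φ (γ p)).comp (fderiv ℝ γ p) := fun p =>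
    fderiv_comp p ((hφ.contDiffAt (hN.mem_nhds (hγN p))).differentiableAt (by simp))
      (hγ.differentiable (by norm_num) p)
  have hγ0 : ∀ t, γ (0, t) = hJ.rotation t x := fun t => by simp [hγ_rot]
  have hγd : ∀ t, fderiv ℝ γ (0, t) (0, 1) = J (hJ.rotation t x) := by
    intro t
    have h := (hγ.differentiable (by norm_num) (0, t)).hasFDerivAt.comp_hasDerivAt t
      ((hasDerivAt_const t (0 : ℝ)).prodMk (hasDerivAt_id t))
    have h0 : (γ ∘ Prod.mk 0) = fun s => hJ.rotation s x := funext hγ0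
    change HasDerivAt (γ ∘ Prod.mk 0) _ t at h
    rw [h0] at h
    exact h.unique (hJ.hasDerivAt_rotation t x)
  have h1 := hJ.integral_action_eq hφγ (b := π / 2) (c := 2 * π)
    (fun θ => congrArg φ (hper θ)) (fun t => congrArg φ (hconst t))
  have h2 := hJ.integral_action_eq hγ (b := π / 2) (c := 2 * π) hper hconst
  simp only [hfd, ContinuousLinearMap.comp_apply, Function.comp_apply, hγ0, hγd,
    hsymp _ (hγN _)] at h1 h2
  rw [h1, ← h2]
  simp only [real_inner_self_eq_norm_sq, hJ.norm_map, LinearIsometryEquiv.norm_map,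
    intervalIntegral.integral_const, sub_zero, smul_eq_mul]

end RotationAction

section Integration

variable {V : Type*} [NormedAddCommGroup V] [InnerProductSpace ℝ V] [FiniteDimensional ℝ V]
  [MeasurableSpace V] [BorelSpace V]

theorem IsOrthoComplexStructure.integral_rotation_average {J : V →L[ℝ] V}
    (hJ : IsOrthoComplexStructure J) {f : V → ℝ} (hf : Continuous f)
    (hsupp : HasCompactSupport f) :
    2 * π * ∫ x, f x = ∫ x, ∫ t in (0 : ℝ)..(2 * π), f (hJ.rotation t x) := by
  have hinv : ∀ (g : V → ℝ) t, ∫ x, g (hJ.rotation t x) = ∫ x, g x := fun g t =>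
    (hJ.rotation t).measurePreserving.integral_comp'
      (f := (hJ.rotation t).toHomeomorph.toMeasurableEquiv) g
  have hfint : Integrable f := hf.integrable_of_hasCompactSupport hsupp
  have hcont : Continuous fun p : ℝ × V => f (hJ.rotation p.1 p.2) := by
    simp only [hJ.rotation_apply]
    fun_prop
  have h_integrable : Integrable (Function.uncurry fun t x => f (hJ.rotation t x))
      ((volume.restrict (Ioc 0 (2 * π))).prod volume) := by
    refine (integrable_prod_iff hcont.aestronglyMeasurable).2 ⟨?_, ?_⟩
    · refine Eventually.of_forall fun t => ?_
      exact (hJ.rotation t).measurePreserving.integrable_comp_of_integrable hfint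
    · simp only [hinv fun x => ‖f x‖]
      exact integrable_const _
  have hswap := integral_integral_swap h_integrable
  simp only [hinv, integral_const] at hswap
  simp only [intervalIntegral.integral_of_le two_pi_pos.le]
  rw [← hswap]
  simp [two_pi_pos.le]

/-- Integration by parts against the Euler vector field. -/
theorem integral_fderiv_apply_self {h : V → ℝ} (hh : ContDiff ℝ 1 h)
    (hsupp : HasCompactSupport h) :
    ∫ y, fderiv ℝ h y y = -(Module.finrank ℝ V * ∫ y, h y) := by
  let b := stdOrthonormalBasis ℝ V
  have hd : Continuous (fderiv ℝ h) := hh.continuous_fderiv one_ne_zero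
  have hfsupp : HasCompactSupport (fderiv ℝ h) := hsupp.fderiv ℝ
  have h_integrable : ∀ i, Integrable fun y => ⟪b i, y⟫ * fderiv ℝ h y (b i) := fun i => by
    refine Continuous.integrable_of_hasCompactSupport (by fun_prop) ?_
    exact (hfsupp.comp_left (g := fun L : V →L[ℝ] ℝ => L (b i)) (by simp)).mul_left
  have hcoord : ∀ i, ∫ y, ⟪b i, y⟫ * fderiv ℝ h y (b i) = -∫ y, h y := by
    intro i
    have hder : ∀ y, fderiv ℝ (fun y => ⟪b i, y⟫) y (b i) = 1 := fun y => by
      rw [show (fun y => ⟪b i, y⟫) = innerSL ℝ (b i) from rfl, ContinuousLinearMap.fderiv]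
      simp [innerSL_apply_apply]
    have hIBP := integral_mul_fderiv_eq_neg_fderiv_mul_of_integrable (μ := volume)
      (f := fun y => ⟪b i, y⟫) (g := h) (v := b i) ?_ (h_integrable i) ?_
      (fun y _ => (innerSL ℝ (b i)).differentiableAt)
      (fun y _ => hh.differentiable one_ne_zero y)
    · simpa only [hder, one_mul] using hIBP
    · simpa only [hder, one_mul] using hh.continuous.integrable_of_hasCompactSupport hsupp
    · exact Continuous.integrable_of_hasCompactSupport
        ((innerSL ℝ (b i)).continuous.mul hh.continuous) hsupp.mul_left
  have hexp : ∀ y, fderiv ℝ h y y = ∑ i, ⟪b i, y⟫ * fderiv ℝ h y (b i) := fun y => by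
    conv_lhs => rw [← b.sum_repr' y, map_sum]
    simp only [b.sum_repr', map_smul, smul_eq_mul]
  simp only [hexp]
  rw [integral_finsetSum _ fun i _ => h_integrable i]
  simp [hcoord]

end Integration

section Gluing

open scoped Classical in
/-- The function equal to `G ∘ φ⁻¹` on `φ '' T` and to the indicator function of `D` elsewhere. -/
def glueIndicator {V : Type*} (φ : V → V) (T D : Set V) (G : V → ℝ) (y : V) : ℝ :=
  if h : ∃ x ∈ T, φ x = y then G h.choose else D.indicator 1 y

variable {V : Type*} {φ : V → V} {T D K : Set V} {G : V → ℝ}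

theorem glueIndicator_map (hinj : InjOn φ T) {x : V} (hx : x ∈ T) :
    glueIndicator φ T D G (φ x) = G x := by
  have h : ∃ z ∈ T, φ z = φ x := ⟨x, hx, rfl⟩
  rw [glueIndicator, dif_pos h, hinj h.choose_spec.1 hx h.choose_spec.2]

theorem glueIndicator_of_notMem (hinj : InjOn φ T)
    (hG : ∀ x ∈ T \ K, G x = D.indicator 1 (φ x)) {y : V} (hy : y ∉ φ '' K) :
    glueIndicator φ T D G y = D.indicator 1 y := by
  by_cases h : ∃ x ∈ T, φ x = y
  · obtain ⟨x, hx, rfl⟩ := h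
    rw [glueIndicator_map hinj hx]
    exact hG x ⟨hx, fun hxK => hy (mem_image_of_mem φ hxK)⟩
  · rw [glueIndicator, dif_neg h]

theorem glueIndicator_eventuallyEq_const [TopologicalSpace V]
    (hinj : InjOn φ T) (hG : ∀ x ∈ T \ K, G x = D.indicator 1 (φ x))
    (hK : IsClosed (φ '' K)) (hfr : frontier D ⊆ φ '' K) {y : V} (hy : y ∉ φ '' K) :
    ∃ c : ℝ, glueIndicator φ T D G =ᶠ[𝓝 y] fun _ => c := by
  have hev : ∀ᶠ z in 𝓝 y, glueIndicator φ T D G z = D.indicator 1 z := by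
    filter_upwards [hK.isOpen_compl.mem_nhds hy] with z hz
    exact glueIndicator_of_notMem hinj hG hz
  have hyfr : y ∉ frontier D := fun h => hy (hfr h)
  by_cases hyD : y ∈ interior D
  · refine ⟨1, ?_⟩
    filter_upwards [hev, isOpen_interior.mem_nhds hyD] with z hz hzD
    rw [hz, indicator_of_mem (interior_subset hzD), Pi.one_apply]
  · have hyc : y ∉ closure D := fun h => hyfr ⟨h, hyD⟩
    refine ⟨0, ?_⟩
    filter_upwards [hev, isClosed_closure.isOpen_compl.mem_nhds hyc] with z hz hzD
    rw [hz, indicator_of_notMem fun h => hzD (subset_closure h)]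

end Gluing

section Volume

variable {V : Type*} [NormedAddCommGroup V] [InnerProductSpace ℝ V] [FiniteDimensional ℝ V]

/-- The derivative of a symplectic map, as a continuous linear equivalence. -/
theorem IsOrthoComplexStructure.exists_equiv_of_symplectic {J : V →L[ℝ] V}
    (hJ : IsOrthoComplexStructure J) {A : V →L[ℝ] V}
    (hA : ∀ v w, ⟪J (A v), A w⟫ = ⟪J v, w⟫) : ∃ e : V ≃L[ℝ] V, (e : V →L[ℝ] V) = A :=
  ⟨(LinearEquiv.ofInjectiveEndo (A : V →ₗ[ℝ] V)
    (hJ.injective_of_symplectic hA)).toContinuousLinearEquiv, rfl⟩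

theorem IsOrthoComplexStructure.isOpen_image {J : V →L[ℝ] V}
    (hJ : IsOrthoComplexStructure J) {T : Set V} (hT : IsOpen T) {φ : V → V}
    (hφ : ContDiffOn ℝ ∞ φ T)
    (hsymp : ∀ p ∈ T, ∀ v w, ⟪J (fderiv ℝ φ p v), fderiv ℝ φ p w⟫ = ⟪J v, w⟫) :
    IsOpen (φ '' T) := by
  refine isOpen_iff_mem_nhds.2 ?_
  rintro _ ⟨x, hx, rfl⟩
  obtain ⟨e, he⟩ := hJ.exists_equiv_of_symplectic (hsymp x hx)
  have hstrict : HasStrictFDerivAt φ (e : V →L[ℝ] V) x := by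
    rw [he]
    exact (hφ.contDiffAt (hT.mem_nhds hx)).hasStrictFDerivAt (by simp)
  rw [← hstrict.map_nhds_eq_of_equiv]
  exact image_mem_map (hT.mem_nhds hx)

theorem IsOrthoComplexStructure.contDiff_glueIndicator {J : V →L[ℝ] V}
    (hJ : IsOrthoComplexStructure J) {T : Set V} (hT : IsOpen T) {φ : V → V}
    (hφ : ContDiffOn ℝ ∞ φ T) (hinj : InjOn φ T)
    (hsymp : ∀ p ∈ T, ∀ v w, ⟪J (fderiv ℝ φ p v), fderiv ℝ φ p w⟫ = ⟪J v, w⟫)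
    {D K : Set V} (hKT : K ⊆ T) {G : V → ℝ} (hGsmooth : ContDiff ℝ 1 G)
    (hG : ∀ x ∈ T \ K, G x = D.indicator 1 (φ x))
    (hK : IsClosed (φ '' K)) (hfr : frontier D ⊆ φ '' K) :
    ContDiff ℝ 1 (glueIndicator φ T D G) := by
  refine contDiff_iff_contDiffAt.2 fun y => ?_
  by_cases hy : y ∈ φ '' K
  · obtain ⟨x, hxK, rfl⟩ := hy
    have hx := hKT hxK
    obtain ⟨e, he⟩ := hJ.exists_equiv_of_symplectic (hsymp x hx)
    have hcd : ContDiffAt ℝ ∞ φ x := hφ.contDiffAt (hT.mem_nhds hx)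
    have hder : HasFDerivAt φ (e : V →L[ℝ] V) x := by
      rw [he]
      exact (hcd.differentiableAt (by simp)).hasFDerivAt
    have hstrict : HasStrictFDerivAt φ (e : V →L[ℝ] V) x := hcd.hasStrictFDerivAt' hder (by simp)
    have hψ : ContDiffAt ℝ ∞ (hstrict.localInverse φ e x) (φ x) :=
      hcd.to_localInverse hder (by simp)
    have hψx : hstrict.localInverse φ e x (φ x) = x := hstrict.localInverse_apply_image
    refine ((hGsmooth.contDiffAt.comp (φ x) (hψ.of_le (by simp)))).congr_of_eventuallyEq ?_
    have hmem : ∀ᶠ z in 𝓝 (φ x), hstrict.localInverse φ e x z ∈ T :=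
      hψ.continuousAt.eventually_mem (by rw [hψx]; exact hT.mem_nhds hx)
    filter_upwards [hmem, hstrict.eventually_right_inverse] with z hz hzr
    conv_lhs => rw [← hzr]
    exact glueIndicator_map hinj hz
  · obtain ⟨c, hc⟩ := glueIndicator_eventuallyEq_const hinj hG hK hfr hy
    exact contDiffAt_const.congr_of_eventuallyEq hc

variable [MeasurableSpace V] [BorelSpace V]

theorem IsOrthoComplexStructure.integral_glueIndicator {J : V →L[ℝ] V}
    (hJ : IsOrthoComplexStructure J) (hdim : 2 < Module.finrank ℝ V)
    {T : Set V} (hT : IsOpen T) (hTsph : ∀ x ∈ T, sphere (0 : V) ‖x‖ ⊆ T) {φ : V → V}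
    (hφ : ContDiffOn ℝ ∞ φ T) (hinj : InjOn φ T)
    (hsymp : ∀ p ∈ T, ∀ v w, ⟪J (fderiv ℝ φ p v), fderiv ℝ φ p w⟫ = ⟪J v, w⟫)
    {D K : Set V} (hD : IsBounded D) (hKT : K ⊆ T) (hK : IsCompact K)
    {g : ℝ → ℝ} (hg : ContDiff ℝ ∞ g) (hgK : ∀ x, x ∉ K → deriv g (‖x‖ ^ 2) = 0)
    (hG : ∀ x ∈ T \ K, g (‖x‖ ^ 2) = D.indicator 1 (φ x)) (hfr : frontier D ⊆ φ '' K) :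
    Integrable (glueIndicator φ T D fun x => g (‖x‖ ^ 2)) ∧
    Module.finrank ℝ V * ∫ y, glueIndicator φ T D (fun x => g (‖x‖ ^ 2)) y =
      -∫ x, fderiv ℝ (fun x : V => g (‖x‖ ^ 2)) x x := by
  let G : V → ℝ := fun x => g (‖x‖ ^ 2)
  let h : V → ℝ := glueIndicator φ T D G
  have hGsmooth : ContDiff ℝ 1 G := (hg.of_le (by simp)).comp (contDiff_id.norm_sq ℝ)
  have hGfd : ∀ x v, fderiv ℝ G x v = 2 * deriv g (‖x‖ ^ 2) * ⟪x, v⟫ := by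
    intro x v
    have h1 := (hg.differentiable (by simp) (‖x‖ ^ 2)).hasDerivAt.comp_hasFDerivAt x
      (hasStrictFDerivAt_norm_sq x).hasFDerivAt
    rw [show fderiv ℝ G x = _ from h1.fderiv]
    simp [innerSL_apply_apply]
    ring
  have hφK : IsCompact (φ '' K) := hK.image_of_continuousOn (hφ.continuousOn.mono hKT)
  have hh : ContDiff ℝ 1 h :=
    hJ.contDiff_glueIndicator hT hφ hinj hsymp hKT hGsmooth hG hφK.isClosed hfr
  have hsupp : HasCompactSupport h := by
    refine HasCompactSupport.intro (hD.isCompact_closure.union hφK) fun y hy => ?_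
    rw [mem_union, not_or] at hy
    exact (glueIndicator_of_notMem hinj hG hy.2).trans
      (indicator_of_notMem (fun hyD => hy.1 (subset_closure hyD)) _)
  refine ⟨hh.continuous.integrable_of_hasCompactSupport hsupp, ?_⟩
  let Φ : V → ℝ := fun x => 2 * deriv g (‖x‖ ^ 2) * ⟪J (φ x), fderiv ℝ φ x (J x)⟫
  have hΦK : ∀ x, x ∉ K → Φ x = 0 := fun x hx => by simp [Φ, hgK x hx]
  have hΦsupp : HasCompactSupport Φ := HasCompactSupport.intro hK hΦK
  have hΦcont : Continuous Φ := by
    refine continuous_iff_continuousAt.2 fun x => ?_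
    by_cases hx : x ∈ K
    · have hxT := hT.mem_nhds (hKT hx)
      have h1 : ContinuousAt φ x := (hφ.contDiffAt hxT).continuousAt
      have h2 : ContinuousAt (fderiv ℝ φ) x :=
        ((hφ.contDiffAt hxT).fderiv_right (m := 0) (by simp)).continuousAt
      have h3 : Continuous (deriv g) := hg.continuous_deriv (by simp)
      exact (continuousAt_const.mul (h3.comp (continuous_norm.pow 2)).continuousAt).mul
        ((J.continuous.continuousAt.comp h1).inner (h2.clm_apply J.continuous.continuousAt))
    · refine (continuousAt_const (y := (0 : ℝ))).congr ?_
      filter_upwards [hK.isClosed.isOpen_compl.mem_nhds hx] with z hz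
      exact (hΦK z hz).symm
  have hpoint : ∀ x ∈ T, |(fderiv ℝ φ x).det| • fderiv ℝ h (φ x) (φ x) = Φ x := by
    intro x hx
    have hdφ := (hφ.contDiffAt (hT.mem_nhds hx)).differentiableAt (by simp)
    obtain ⟨e, he⟩ := hJ.exists_equiv_of_symplectic (hsymp x hx)
    have hw : fderiv ℝ φ x (e.symm (φ x)) = φ x := by rw [← he]; simp
    have hcomp : fderiv ℝ G x = (fderiv ℝ h (φ x)).comp (fderiv ℝ φ x) := by
      rw [← fderiv_comp x (hh.differentiable one_ne_zero _) hdφ]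
      refine Filter.EventuallyEq.fderiv_eq ?_
      filter_upwards [hT.mem_nhds hx] with z hz
      exact (glueIndicator_map hinj hz).symm
    have h1 : fderiv ℝ h (φ x) (φ x) = fderiv ℝ G x (e.symm (φ x)) := by
      rw [hcomp, ContinuousLinearMap.comp_apply, hw]
    have h2 : ⟪J (φ x), fderiv ℝ φ x (J x)⟫ = ⟪x, e.symm (φ x)⟫ := by
      conv_lhs => rw [← hw]
      rw [hsymp x hx, hJ.inner_map, real_inner_comm]
    rw [hJ.abs_det_of_symplectic (hsymp x hx), one_smul, h1, hGfd, ← h2]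
  have hchange : ∫ y, fderiv ℝ h y y = ∫ x, Φ x := by
    have hoff : ∀ y, y ∉ φ '' T → fderiv ℝ h y y = 0 := by
      intro y hy
      obtain ⟨c, hc⟩ := glueIndicator_eventuallyEq_const hinj hG hφK.isClosed hfr
        fun hyK => hy (image_mono hKT hyK)
      rw [Filter.EventuallyEq.fderiv_eq hc]
      simp
    rw [← setIntegral_eq_integral_of_forall_compl_eq_zero hoff,
      integral_image_eq_integral_abs_det_fderiv_smul volume hT.measurableSet
        (fun x hx => ((hφ.contDiffAt (hT.mem_nhds hx)).differentiableAt
          (by simp)).hasFDerivAt.hasFDerivWithinAt) hinj,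
      setIntegral_congr_fun hT.measurableSet hpoint]
    exact setIntegral_eq_integral_of_forall_compl_eq_zero fun x hx => hΦK x fun hxK => hx (hKT hxK)
  have havg : ∫ x, Φ x = ∫ x, fderiv ℝ G x x := by
    have h1 := hJ.integral_rotation_average hΦcont hΦsupp
    have h2 : ∀ x, ∫ t in (0 : ℝ)..(2 * π), Φ (hJ.rotation t x) = 2 * π * fderiv ℝ G x x := by
      intro x
      rw [hGfd]
      simp only [Φ, LinearIsometryEquiv.norm_map, intervalIntegral.integral_const_mul]
      by_cases hx : x ∈ T
      · rw [hJ.integral_rotation_action hdim hT hφ hsymp (hTsph x hx),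
          real_inner_self_eq_norm_sq]
        ring
      · simp [hgK x fun hxK => hx (hKT hxK)]
    simp only [h2, integral_const_mul] at h1
    exact mul_left_cancel₀ two_pi_pos.ne' h1
  have hIBP := integral_fderiv_apply_self hh hsupp
  change _ * ∫ y, h y = -∫ x, fderiv ℝ G x x
  rw [← havg, ← hchange, hIBP, neg_neg]

end Volume

section Cutoff

/-- A smooth function equal to `1` on `(-∞, α]` and to `0` on `[β, ∞)`. -/
def smoothCutoff (α β s : ℝ) : ℝ := smoothTransition ((β - s) / (β - α))

variable {α β s : ℝ}

theorem contDiff_smoothCutoff : ContDiff ℝ ∞ (smoothCutoff α β) :=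
  smoothTransition.contDiff.comp ((contDiff_const.sub contDiff_id).div_const _)

theorem smoothCutoff_nonneg : 0 ≤ smoothCutoff α β s := smoothTransition.nonneg _

theorem smoothCutoff_le_one : smoothCutoff α β s ≤ 1 := smoothTransition.le_one _

theorem smoothCutoff_eq_one (h : α < β) (hs : s ≤ α) : smoothCutoff α β s = 1 :=
  smoothTransition.one_of_one_le ((one_le_div (sub_pos.2 h)).2 (by linarith))

theorem smoothCutoff_eq_zero (h : α < β) (hs : β ≤ s) : smoothCutoff α β s = 0 :=
  smoothTransition.zero_of_nonpos (div_nonpos_of_nonpos_of_nonneg (by linarith) (by linarith))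

theorem deriv_smoothCutoff_eq_zero (h : α < β) (hs : s < α ∨ β < s) :
    deriv (smoothCutoff α β) s = 0 := by
  rcases hs with hs | hs
  · have : smoothCutoff α β =ᶠ[𝓝 s] fun _ => 1 := by
      filter_upwards [Iio_mem_nhds hs] with t ht using smoothCutoff_eq_one h (le_of_lt ht)
    rw [this.deriv_eq, deriv_const]
  · have : smoothCutoff α β =ᶠ[𝓝 s] fun _ => 0 := by
      filter_upwards [Ioi_mem_nhds hs] with t ht using smoothCutoff_eq_zero h (le_of_lt ht)
    rw [this.deriv_eq, deriv_const]

variable {V : Type*} [NormedAddCommGroup V] [InnerProductSpace ℝ V]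

theorem contDiff_smoothCutoff_norm_sq :
    ContDiff ℝ 1 fun x : V => smoothCutoff α β (‖x‖ ^ 2) :=
  (contDiff_smoothCutoff.of_le (by simp)).comp (contDiff_id.norm_sq ℝ)

variable [FiniteDimensional ℝ V]

theorem hasCompactSupport_smoothCutoff_norm_sq (h : α < β) :
    HasCompactSupport fun x : V => smoothCutoff α β (‖x‖ ^ 2) := by
  refine HasCompactSupport.intro (isCompact_closedBall (0 : V) √β) fun x hx => ?_
  refine smoothCutoff_eq_zero h ?_
  rw [mem_closedBall_zero_iff, not_le] at hx
  exact ((sqrt_lt' ((sqrt_nonneg _).trans_lt hx)).1 hx).le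

variable [MeasurableSpace V] [BorelSpace V]

theorem integral_fderiv_smoothCutoff_norm_sq (h : α < β) :
    ∫ x : V, fderiv ℝ (fun x : V => smoothCutoff α β (‖x‖ ^ 2)) x x =
      -(Module.finrank ℝ V * ∫ x : V, smoothCutoff α β (‖x‖ ^ 2)) :=
  integral_fderiv_apply_self contDiff_smoothCutoff_norm_sq
    (hasCompactSupport_smoothCutoff_norm_sq h)

theorem volume_real_ball_le_integral_smoothCutoff {a : ℝ} (h : a ^ 2 < β) :
    volume.real (ball (0 : V) a) ≤ ∫ x : V, smoothCutoff (a ^ 2) β (‖x‖ ^ 2) := by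
  rw [← integral_indicator_one measurableSet_ball]
  refine integral_mono ((integrable_indicator_iff measurableSet_ball).2
    (integrableOn_const measure_ball_lt_top.ne)) ?_ fun x => ?_
  · exact contDiff_smoothCutoff_norm_sq.continuous.integrable_of_hasCompactSupport
      (hasCompactSupport_smoothCutoff_norm_sq h)
  · by_cases hx : x ∈ ball (0 : V) a
    · rw [indicator_of_mem hx]
      rw [mem_ball_zero_iff] at hx
      exact (smoothCutoff_eq_one h (pow_le_pow_left₀ (norm_nonneg _) hx.le 2)).ge
    · rw [indicator_of_notMem hx]
      exact smoothCutoff_nonneg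

end Cutoff

section Component

theorem closure_connectedComponentIn_subset {X : Type*} [TopologicalSpace X]
    [LocallyConnectedSpace X] {F : Set X} (hF : IsClosed F) (x : X) :
    closure (connectedComponentIn Fᶜ x) ⊆ connectedComponentIn Fᶜ x ∪ F := by
  intro y hy
  by_cases hyF : y ∈ F
  · exact Or.inr hyF
  · left
    have hopen : IsOpen (connectedComponentIn Fᶜ y) := hF.isOpen_compl.connectedComponentIn
    obtain ⟨z, hzy, hzx⟩ := mem_closure_iff.1 hy _ hopen (mem_connectedComponentIn hyF)
    rw [connectedComponentIn_eq hzx, ← connectedComponentIn_eq hzy]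
    exact mem_connectedComponentIn hyF

theorem subset_or_disjoint_connectedComponentIn {X : Type*} [TopologicalSpace X]
    {F s : Set X} (hs : IsPreconnected s) (hsF : s ⊆ F) (x : X) :
    s ⊆ connectedComponentIn F x ∨ Disjoint s (connectedComponentIn F x) := by
  by_cases h : Disjoint s (connectedComponentIn F x)
  · exact Or.inr h
  · left
    obtain ⟨y, hys, hyx⟩ := not_disjoint_iff.1 h
    rw [connectedComponentIn_eq hyx]
    exact hs.subset_connectedComponentIn hys hsF

theorem not_isClopen_of_isBounded {V : Type*} [NormedAddCommGroup V] [NormedSpace ℝ V]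
    [Nontrivial V] {s : Set V} (hs : s.Nonempty) (hb : IsBounded s) : ¬IsClopen s := by
  intro h
  rw [h.eq_univ hs] at hb
  exact NormedSpace.unbounded_univ ℝ V hb

theorem isPreconnected_setOf_norm_mem_Ioo {V : Type*} [NormedAddCommGroup V] [NormedSpace ℝ V]
    (hrank : 1 < Module.rank ℝ V) {a b : ℝ} (ha : 0 ≤ a) :
    IsPreconnected {x : V | ‖x‖ ∈ Ioo a b} := by
  have himage : {x : V | ‖x‖ ∈ Ioo a b} =
      (fun p : ℝ × V => p.1 • p.2) '' (Ioo a b ×ˢ sphere (0 : V) 1) := by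
    ext x
    constructor
    · intro hx
      have hpos : ‖x‖ ≠ 0 := (ha.trans_lt hx.1).ne'
      refine ⟨(‖x‖, ‖x‖⁻¹ • x), ⟨hx, ?_⟩, ?_⟩
      · rw [mem_sphere_zero_iff_norm, norm_smul, norm_inv, norm_norm, inv_mul_cancel₀ hpos]
      · simp [smul_smul, hpos]
    · rintro ⟨⟨s, v⟩, ⟨hs, hv⟩, rfl⟩
      rw [mem_sphere_zero_iff_norm] at hv
      have hs0 : 0 ≤ s := ha.trans hs.1.le
      simpa [norm_smul, hv, abs_of_nonneg hs0] using hs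
  rw [himage]
  exact (isPreconnected_Ioo.prod (isPreconnected_sphere hrank 0 1)).image _
    (continuous_fst.smul continuous_snd).continuousOn

theorem exists_shell_subset {V : Type*} [NormedAddCommGroup V] [NormedSpace ℝ V]
    [FiniteDimensional ℝ V] {r : ℝ} (hr : 0 < r) {N : Set V} (hN : IsOpen N)
    (hS : sphere (0 : V) r ⊆ N) : ∃ δ, 0 < δ ∧ δ ≤ r ∧ {x : V | ‖x‖ ∈ Ioo (r - δ) (r + δ)} ⊆ N := by
  obtain ⟨δ, hδ, hsub⟩ := (isCompact_sphere (0 : V) r).exists_thickening_subset_open hN hS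
  refine ⟨min δ r, lt_min hδ hr, min_le_right _ _, fun x hx => hsub ?_⟩
  have h1 : r - min δ r < ‖x‖ := hx.1
  have h2 : ‖x‖ < r + min δ r := hx.2
  have h3 := min_le_left δ r
  have hpos : 0 < ‖x‖ := by linarith [min_le_right δ r]
  refine mem_thickening_iff.2 ⟨(r / ‖x‖) • x, ?_, ?_⟩
  · rw [mem_sphere_zero_iff_norm, norm_smul, norm_div, norm_norm, norm_of_nonneg hr.le,
      div_mul_cancel₀ _ hpos.ne']
  · have : x - (r / ‖x‖) • x = ((‖x‖ - r) / ‖x‖) • x := by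
      rw [sub_div, div_self hpos.ne', sub_smul, one_smul]
    rw [dist_eq_norm, this, norm_smul, norm_div, norm_norm, div_mul_cancel₀ _ hpos.ne',
      norm_eq_abs, abs_lt]
    constructor <;> linarith

variable {V : Type*} [NormedAddCommGroup V] [NormedSpace ℝ V] [FiniteDimensional ℝ V]

/-- A bounded component of the complement of an embedded sphere with a spherical collar contains
exactly one of the two sides of the collar. -/
theorem bounded_component_collar_sides (hrank : 1 < Module.rank ℝ V) {r δ : ℝ} (hδ : 0 < δ)
    (hδr : δ ≤ r) {φ : V → V} (hφ : ContinuousOn φ {x | ‖x‖ ∈ Ioo (r - δ) (r + δ)})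
    (hinj : InjOn φ {x | ‖x‖ ∈ Ioo (r - δ) (r + δ)})
    (hopen : IsOpen (φ '' {x | ‖x‖ ∈ Ioo (r - δ) (r + δ)})) {x : V}
    (hx : x ∈ (φ '' sphere (0 : V) r)ᶜ)
    (hbd : IsBounded (connectedComponentIn (φ '' sphere (0 : V) r)ᶜ x)) :
    ((∀ z, ‖z‖ ∈ Ioo (r - δ) r → φ z ∈ connectedComponentIn (φ '' sphere (0 : V) r)ᶜ x) ∧
      ∀ z, ‖z‖ ∈ Ioo r (r + δ) → φ z ∉ connectedComponentIn (φ '' sphere (0 : V) r)ᶜ x) ∨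
    ((∀ z, ‖z‖ ∈ Ioo (r - δ) r → φ z ∉ connectedComponentIn (φ '' sphere (0 : V) r)ᶜ x) ∧
      ∀ z, ‖z‖ ∈ Ioo r (r + δ) → φ z ∈ connectedComponentIn (φ '' sphere (0 : V) r)ᶜ x) := by
  have hnontriv : Nontrivial V := (rank_pos_iff_nontrivial (R := ℝ)).1 (zero_lt_one.trans hrank)
  set T : Set V := {x | ‖x‖ ∈ Ioo (r - δ) (r + δ)} with hT
  set F := φ '' sphere (0 : V) r with hFdef
  set D := connectedComponentIn Fᶜ x with hDdef
  have hST : sphere (0 : V) r ⊆ T := fun z hz => by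
    rw [mem_sphere_zero_iff_norm] at hz
    change ‖z‖ ∈ Ioo (r - δ) (r + δ)
    rw [hz]
    exact ⟨by linarith, by linarith⟩
  have hF : IsClosed F :=
    ((isCompact_sphere (0 : V) r).image_of_continuousOn (hφ.mono hST)).isClosed
  have hDopen : IsOpen D := hF.isOpen_compl.connectedComponentIn
  have hDne : D.Nonempty := ⟨x, mem_connectedComponentIn hx⟩
  have hcl : closure D ⊆ D ∪ F := closure_connectedComponentIn_subset hF x
  have havoid : ∀ z ∈ T, ‖z‖ ≠ r → φ z ∈ Fᶜ := by
    rintro z hz hzr ⟨w, hw, hwz⟩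
    rw [hinj (hST hw) hz hwz, mem_sphere_zero_iff_norm] at hw
    exact hzr hw
  have hside : ∀ a b, r - δ ≤ a → b ≤ r + δ → r ∉ Ioo a b →
      (∀ z, ‖z‖ ∈ Ioo a b → φ z ∈ D) ∨ ∀ z, ‖z‖ ∈ Ioo a b → φ z ∉ D := by
    intro a b ha hb hr
    have hsub : {z : V | ‖z‖ ∈ Ioo a b} ⊆ T := fun z hz => Ioo_subset_Ioo ha hb hz
    have hpre := (isPreconnected_setOf_norm_mem_Ioo (V := V) hrank (a := a) (b := b)
      (by linarith)).image φ (hφ.mono hsub)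
    refine (subset_or_disjoint_connectedComponentIn (F := Fᶜ) hpre ?_ x).imp ?_ ?_
    · rintro _ ⟨z, hz, rfl⟩
      exact havoid z (hsub hz) fun h => hr (h ▸ hz)
    · exact fun h z hz => h (mem_image_of_mem φ hz)
    · exact fun h z hz hzD => disjoint_left.1 h (mem_image_of_mem φ hz) hzD
  have hcover : ∀ z ∈ T, φ z ∉ F → ‖z‖ ∈ Ioo (r - δ) r ∨ ‖z‖ ∈ Ioo r (r + δ) := by
    intro z hz hzF
    rcases lt_trichotomy ‖z‖ r with h | h | h
    · exact Or.inl ⟨hz.1, h⟩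
    · exact absurd (mem_image_of_mem φ (mem_sphere_zero_iff_norm.2 h)) hzF
    · exact Or.inr ⟨h, hz.2⟩
  rcases hside (r - δ) r le_rfl (by linarith) (by simp) with hin | hin <;>
    rcases hside r (r + δ) (by linarith) le_rfl (by simp) with hout | hout
  · exfalso
    have hunion : D ∪ F = D ∪ φ '' T := by
      refine (union_subset_union_right _ (image_mono hST)).antisymm
        (union_subset subset_union_left ?_)
      rintro _ ⟨z, hz, rfl⟩
      by_cases hzF : φ z ∈ F
      · exact Or.inr hzF
      · exact Or.inl ((hcover z hz hzF).elim (hin z) (hout z))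
    refine not_isClopen_of_isBounded (s := D ∪ F) (hDne.mono subset_union_left)
      (hbd.union ?_) ⟨?_, ?_⟩
    · exact ((isCompact_sphere (0 : V) r).image_of_continuousOn (hφ.mono hST)).isBounded
    · refine isClosed_of_closure_subset ?_
      rw [closure_union, hF.closure_eq]
      exact union_subset hcl subset_union_right
    · rw [hunion]
      exact hDopen.union hopen
  · exact Or.inl ⟨hin, hout⟩
  · exact Or.inr ⟨hin, hout⟩
  · exfalso
    have hdisj : Disjoint (φ '' T) D := by
      rw [disjoint_left]
      rintro _ ⟨z, hz, rfl⟩ hzD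
      exact (hcover z hz (connectedComponentIn_subset _ _ hzD)).elim
        (fun h => hin z h hzD) (fun h => hout z h hzD)
    refine not_isClopen_of_isBounded hDne hbd ⟨isClosed_of_closure_subset fun y hy => ?_, hDopen⟩
    refine (hcl hy).elim id fun hyF => ?_
    exact absurd hy (disjoint_left.1 (hdisj.closure_right hopen) (image_mono hST hyF))

end Component

section BoundedComponent

variable {V : Type*} [NormedAddCommGroup V] [InnerProductSpace ℝ V] [FiniteDimensional ℝ V]
  [MeasurableSpace V] [BorelSpace V]

theorem volume_real_ball_eq {a : ℝ} (ha : 0 < a) : volume.real (ball (0 : V) a) =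
    a ^ Module.finrank ℝ V * volume.real (ball (0 : V) 1) := by
  rw [measureReal_def, Measure.addHaar_ball_of_pos _ _ ha, ENNReal.toReal_mul,
    ENNReal.toReal_ofReal (by positivity), measureReal_def]

theorem volume_real_ball_le_of_forall_lt {r c : ℝ} (hr : 0 < r) {s : ℝ} (hs : s < r)
    (h : ∀ a, s < a → 0 < a → a < r → volume.real (ball (0 : V) a) ≤ c) :
    volume.real (ball (0 : V) r) ≤ c := by
  rw [volume_real_ball_eq hr]
  have hlim : Tendsto (fun a : ℝ => a ^ Module.finrank ℝ V * volume.real (ball (0 : V) 1))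
      (𝓝[<] r) (𝓝 (r ^ Module.finrank ℝ V * volume.real (ball (0 : V) 1))) :=
    ((continuous_id.pow _).mul continuous_const).continuousAt.tendsto.mono_left
      nhdsWithin_le_nhds
  refine le_of_tendsto hlim ?_
  filter_upwards [Ioo_mem_nhdsLT (max_lt hs hr)] with a ha
  have ha0 : 0 < a := (le_max_right _ _).trans_lt ha.1
  rw [← volume_real_ball_eq ha0]
  exact h a ((le_max_left _ _).trans_lt ha.1) ha0 ha.2

/-- If a neighbourhood of a round sphere is embedded symplectically, then a bounded component of
the complement of the image of the sphere has at least the volume of the round ball. -/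
theorem IsOrthoComplexStructure.volume_real_ball_le {J : V →L[ℝ] V}
    (hJ : IsOrthoComplexStructure J) (hdim : 2 < Module.finrank ℝ V) {r : ℝ} (hr : 0 < r)
    {N : Set V} (hN : IsOpen N) (hSN : sphere (0 : V) r ⊆ N) {φ : V → V}
    (hφ : ContDiffOn ℝ ∞ φ N) (hinj : InjOn φ N)
    (hsymp : ∀ p ∈ N, ∀ v w, ⟪J (fderiv ℝ φ p v), fderiv ℝ φ p w⟫ = ⟪J v, w⟫)
    {x : V} (hx : x ∈ (φ '' sphere (0 : V) r)ᶜ)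
    (hbd : IsBounded (connectedComponentIn (φ '' sphere (0 : V) r)ᶜ x)) :
    volume.real (ball (0 : V) r) ≤
      volume.real (connectedComponentIn (φ '' sphere (0 : V) r)ᶜ x) := by
  obtain ⟨δ, hδ, hδr, hTN⟩ := exists_shell_subset hr hN hSN
  have hrank : 1 < Module.rank ℝ V := by
    rw [← Module.finrank_eq_rank ℝ V]
    exact_mod_cast (by omega : 1 < Module.finrank ℝ V)
  set T : Set V := {x | ‖x‖ ∈ Ioo (r - δ) (r + δ)}
  have hT : IsOpen T := isOpen_Ioo.preimage continuous_norm
  have hTsph : ∀ z ∈ T, sphere (0 : V) ‖z‖ ⊆ T := fun z hz w hw => by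
    rw [mem_sphere_zero_iff_norm] at hw
    change ‖w‖ ∈ Ioo (r - δ) (r + δ)
    rw [hw]
    exact hz
  have hφT := hφ.mono hTN
  have hinjT := hinj.mono hTN
  have hsympT : ∀ p ∈ T, ∀ v w, ⟪J (fderiv ℝ φ p v), fderiv ℝ φ p w⟫ = ⟪J v, w⟫ :=
    fun p hp => hsymp p (hTN hp)
  have hsides := bounded_component_collar_sides hrank hδ hδr hφT.continuousOn hinjT
    (hJ.isOpen_image hT hφT hsympT) hx hbd
  set F := φ '' sphere (0 : V) r
  set D := connectedComponentIn Fᶜ x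
  have hF : IsClosed F := ((isCompact_sphere (0 : V) r).image_of_continuousOn
    (hφ.continuousOn.mono hSN)).isClosed
  have hDopen : IsOpen D := hF.isOpen_compl.connectedComponentIn
  have hDfin : volume D ≠ ⊤ := hbd.measure_lt_top.ne
  let K : ℝ → ℝ → Set V := fun a b => closedBall 0 b \ ball 0 a
  have hKmem : ∀ a b z, z ∈ K a b ↔ a ≤ ‖z‖ ∧ ‖z‖ ≤ b := fun a b z => by
    rw [Set.mem_sdiff, mem_closedBall_zero_iff, mem_ball_zero_iff, not_lt, and_comm]
  have hKcompact : ∀ a b, IsCompact (K a b) := fun a b =>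
    (isCompact_closedBall (0 : V) b).diff isOpen_ball
  have hKT : ∀ a b, r - δ < a → b < r + δ → K a b ⊆ T := fun a b ha hb z hz => by
    rw [hKmem] at hz
    exact ⟨ha.trans_le hz.1, hz.2.trans_lt hb⟩
  have hfr : ∀ a b, a ≤ r → r ≤ b → frontier D ⊆ φ '' K a b := by
    intro a b ha hb y hy
    have hyF : y ∈ F := by
      rw [hDopen.frontier_eq] at hy
      exact (closure_connectedComponentIn_subset hF x hy.1).resolve_left hy.2
    refine image_mono (fun z hz => ?_) hyF
    rw [mem_sphere_zero_iff_norm] at hz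
    rw [hKmem, hz]
    exact ⟨ha, hb⟩
  have hcutK : ∀ a b, 0 < a → a < b → ∀ z, z ∉ K a b →
      deriv (smoothCutoff (a ^ 2) (b ^ 2)) (‖z‖ ^ 2) = 0 := by
    intro a b ha hab z hz
    refine deriv_smoothCutoff_eq_zero (pow_lt_pow_left₀ hab ha.le two_ne_zero) ?_
    rw [hKmem, not_and_or, not_le, not_le] at hz
    exact hz.imp (fun h => pow_lt_pow_left₀ h (norm_nonneg _) two_ne_zero)
      (fun h => pow_lt_pow_left₀ h (ha.trans hab).le two_ne_zero)
  have hm : (Module.finrank ℝ V : ℝ) ≠ 0 := by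
    exact_mod_cast (by omega : Module.finrank ℝ V ≠ 0)
  rcases hsides with ⟨hin, hout⟩ | ⟨hin, hout⟩
  · refine volume_real_ball_le_of_forall_lt (s := r - δ) hr (by linarith) fun a haδ ha har => ?_
    have hsq : a ^ 2 < r ^ 2 := pow_lt_pow_left₀ har ha.le two_ne_zero
    have hG : ∀ z ∈ T \ K a r,
        smoothCutoff (a ^ 2) (r ^ 2) (‖z‖ ^ 2) = D.indicator 1 (φ z) := by
      intro z hz
      obtain ⟨hzT, hzK⟩ := hz
      rw [hKmem, not_and_or, not_le, not_le] at hzK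
      rcases hzK with h | h
      · rw [indicator_of_mem (hin z ⟨hzT.1, h.trans har⟩), Pi.one_apply]
        exact smoothCutoff_eq_one hsq (pow_le_pow_left₀ (norm_nonneg _) h.le 2)
      · rw [indicator_of_notMem (hout z ⟨h, hzT.2⟩)]
        exact smoothCutoff_eq_zero hsq (pow_le_pow_left₀ hr.le h.le 2)
    obtain ⟨h_integrable, heq⟩ := hJ.integral_glueIndicator hdim hT hTsph hφT hinjT hsympT hbd
      (hKT a r haδ (by linarith)) (hKcompact a r) contDiff_smoothCutoff (hcutK a r ha har)
      hG (hfr a r har.le le_rfl)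
    rw [integral_fderiv_smoothCutoff_norm_sq hsq, neg_neg] at heq
    have heq' := mul_left_cancel₀ hm heq
    refine (volume_real_ball_le_integral_smoothCutoff hsq).trans (heq'.symm.le.trans ?_)
    rw [← integral_indicator_one hDopen.measurableSet]
    refine integral_mono h_integrable ((integrable_indicator_iff hDopen.measurableSet).2
      (integrableOn_const hDfin)) fun y => ?_
    by_cases hy : y ∈ φ '' T
    · obtain ⟨z, hz, rfl⟩ := hy
      dsimp only
      rw [glueIndicator_map hinjT hz]
      by_cases hzr : ‖z‖ < r
      · rw [indicator_of_mem (hin z ⟨hz.1, hzr⟩)]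
        exact smoothCutoff_le_one
      · rw [smoothCutoff_eq_zero hsq (pow_le_pow_left₀ hr.le (not_lt.1 hzr) 2)]
        exact indicator_nonneg (fun _ _ => zero_le_one) _
    · dsimp only
      rw [glueIndicator, dif_neg (show ¬∃ z ∈ T, φ z = y from hy)]
  · exfalso
    have hrb : r < r + δ / 2 := by linarith
    have hsq : r ^ 2 < (r + δ / 2) ^ 2 := pow_lt_pow_left₀ hrb hr.le two_ne_zero
    have hG : ∀ z ∈ T \ K r (r + δ / 2),
        1 - smoothCutoff (r ^ 2) ((r + δ / 2) ^ 2) (‖z‖ ^ 2) = D.indicator 1 (φ z) := by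
      intro z hz
      obtain ⟨hzT, hzK⟩ := hz
      rw [hKmem, not_and_or, not_le, not_le] at hzK
      rcases hzK with h | h
      · rw [indicator_of_notMem (hin z ⟨hzT.1, h⟩),
          smoothCutoff_eq_one hsq (pow_le_pow_left₀ (norm_nonneg _) h.le 2), sub_self]
      · rw [indicator_of_mem (hout z ⟨hrb.trans h, hzT.2⟩),
          smoothCutoff_eq_zero hsq (pow_le_pow_left₀ (by linarith) h.le 2), sub_zero,
          Pi.one_apply]
    obtain ⟨-, heq⟩ := hJ.integral_glueIndicator hdim hT hTsph hφT hinjT hsympT hbd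
      (hKT r (r + δ / 2) (by linarith) (by linarith)) (hKcompact r (r + δ / 2))
      (g := fun s => 1 - smoothCutoff (r ^ 2) ((r + δ / 2) ^ 2) s)
      (contDiff_const.sub contDiff_smoothCutoff)
      (fun z hz => by rw [deriv_const_sub, hcutK r _ hr hrb z hz, neg_zero])
      hG (hfr r (r + δ / 2) le_rfl hrb.le)
    simp only [fderiv_const_sub, neg_apply, integral_neg] at heq
    rw [integral_fderiv_smoothCutoff_norm_sq hsq, neg_neg, ← mul_neg] at heq
    have heq' := mul_left_cancel₀ hm heq
    have hball := volume_real_ball_le_integral_smoothCutoff (V := V) hsq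
    have hpos : 0 < volume.real (ball (0 : V) r) :=
      ENNReal.toReal_pos (measure_ball_pos _ _ hr).ne' measure_ball_lt_top.ne
    have hnonneg : 0 ≤ ∫ y, glueIndicator φ T D
        (fun z => 1 - smoothCutoff (r ^ 2) ((r + δ / 2) ^ 2) (‖z‖ ^ 2)) y := by
      refine integral_nonneg fun y => ?_
      by_cases hy : y ∈ φ '' T
      · obtain ⟨z, hz, rfl⟩ := hy
        rw [glueIndicator_map hinjT hz]
        exact sub_nonneg.2 smoothCutoff_le_one
      · rw [glueIndicator, dif_neg (show ¬∃ z ∈ T, φ z = y from hy)]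
        exact indicator_nonneg (fun _ _ => zero_le_one) _
    linarith

end BoundedComponent

section StandardStructure

theorem Fin.sum_univ_two_mul {M : Type*} [AddCommMonoid M] {n : ℕ} (f : Fin (2 * n) → M) :
    ∑ j, f j = ∑ i : Fin n, (f ⟨2 * i.1, by have := i.isLt; omega⟩ +
      f ⟨2 * i.1 + 1, by have := i.isLt; omega⟩) := by
  have key : ∀ (F : ℕ → M) (m : ℕ), ∑ j ∈ Finset.range (2 * m), F j =
      ∑ i ∈ Finset.range m, (F (2 * i) + F (2 * i + 1)) := by
    intro F m
    induction m with
    | zero => simp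
    | succ m ih =>
      rw [Finset.sum_range_succ, ← ih, Nat.mul_succ, Finset.sum_range_succ,
        Finset.sum_range_succ, add_assoc]
  let F : ℕ → M := fun j => if h : j < 2 * n then f ⟨j, h⟩ else 0
  have hF : ∀ j : Fin (2 * n), f j = F j := fun j => by simp [F]
  simp only [hF]
  rw [Fin.sum_univ_eq_sum_range, key, ← Fin.sum_univ_eq_sum_range fun i => F (2 * i) + F (2 * i + 1)]

/-- The standard complex structure of `ℝ^{2n}`. -/
def stdComplexStructure (n : ℕ) : R2n n →L[ℝ] R2n n :=
  LinearMap.toContinuousLinearMap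
    { toFun := fun v => WithLp.toLp 2 fun k =>
        if h : k.1 % 2 = 0 then -v ⟨k.1 + 1, by have := k.isLt; omega⟩
        else v ⟨k.1 - 1, by have := k.isLt; omega⟩
      map_add' := fun v w => by
        ext k
        by_cases h : k.1 % 2 = 0
        · simp [h, -neg_add_rev, neg_add]
        · simp [h]
      map_smul' := fun c v => by
        ext k
        by_cases h : k.1 % 2 = 0 <;> simp [h] }

variable {n : ℕ}

theorem stdComplexStructure_even (v : R2n n) (i : ℕ) (h : 2 * i < 2 * n) :
    stdComplexStructure n v ⟨2 * i, h⟩ = -v ⟨2 * i + 1, by omega⟩ := by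
  simp [stdComplexStructure]

theorem stdComplexStructure_odd (v : R2n n) (i : ℕ) (h : 2 * i + 1 < 2 * n) :
    stdComplexStructure n v ⟨2 * i + 1, h⟩ = v ⟨2 * i, by omega⟩ := by
  simp [stdComplexStructure]

theorem inner_eq_sum_pairs (v w : R2n n) : ⟪v, w⟫ = ∑ i : Fin n,
    (v ⟨2 * i.1, by have := i.isLt; omega⟩ * w ⟨2 * i.1, by have := i.isLt; omega⟩ +
      v ⟨2 * i.1 + 1, by have := i.isLt; omega⟩ * w ⟨2 * i.1 + 1, by have := i.isLt; omega⟩) := by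
  rw [PiLp.inner_apply, Fin.sum_univ_two_mul]
  simp [mul_comm]

theorem sympForm_eq_inner (v w : R2n n) : sympForm n v w = ⟪stdComplexStructure n v, w⟫ := by
  rw [inner_eq_sum_pairs, sympForm]
  refine Finset.sum_congr rfl fun i _ => ?_
  rw [stdComplexStructure_even, stdComplexStructure_odd]
  ring

theorem isOrthoComplexStructure_std (n : ℕ) :
    IsOrthoComplexStructure (stdComplexStructure n) where
  sq v := by
    ext ⟨k, hk⟩
    obtain ⟨i, rfl | rfl⟩ := Nat.even_or_odd' k
    · rw [stdComplexStructure_even, stdComplexStructure_odd, PiLp.neg_apply]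
    · rw [stdComplexStructure_odd, stdComplexStructure_even, PiLp.neg_apply]
  inner_map v w := by
    rw [inner_eq_sum_pairs, inner_eq_sum_pairs]
    refine Finset.sum_congr rfl fun i _ => ?_
    simp only [stdComplexStructure_even, stdComplexStructure_odd]
    ring

end StandardStructure

section Ellipsoid

open scoped Pointwise

variable {n : ℕ} {a : Fin n → ℝ}

theorem norm_sq_eq_sum_pairs (z : R2n n) : ‖z‖ ^ 2 = ∑ i : Fin n,
    ((z ⟨2 * i.1, by have := i.isLt; omega⟩) ^ 2 +
      (z ⟨2 * i.1 + 1, by have := i.isLt; omega⟩) ^ 2) := by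
  rw [← real_inner_self_eq_norm_sq, inner_eq_sum_pairs]
  simp only [sq]

theorem isOpen_ellipsoid (n : ℕ) (a : Fin n → ℝ) : IsOpen (ellipsoid n a) := by
  refine isOpen_lt ?_ continuous_const
  unfold ellQ
  fun_prop

theorem ellipsoid_const_mul {c : ℝ} (hc : c ≠ 0) :
    ellipsoid n (fun i => c * a i) = c • ellipsoid n a := by
  ext z
  rw [mem_smul_set_iff_inv_smul_mem₀ hc]
  change ellQ n _ z < 1 ↔ ellQ n a _ < 1
  have : ellQ n (fun i => c * a i) z = ellQ n a (c⁻¹ • z) := by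
    refine Finset.sum_congr rfl fun i _ => ?_
    simp only [PiLp.smul_apply, smul_eq_mul, mul_pow, inv_pow, ← mul_add]
    rw [div_mul_eq_div_div, div_eq_inv_mul _ (c ^ 2)]
  rw [this]

theorem volume_real_ellipsoid_const_mul {c : ℝ} (hc : 0 < c) :
    volume.real (ellipsoid n fun i => c * a i) = c ^ (2 * n) * volume.real (ellipsoid n a) := by
  rw [ellipsoid_const_mul hc.ne', measureReal_def, Measure.addHaar_smul_of_nonneg _ hc.le,
    ENNReal.toReal_mul, ENNReal.toReal_ofReal (by positivity), finrank_euclideanSpace_fin,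
    measureReal_def]

theorem ellipsoid_subset_ellipsoid {b : Fin n → ℝ} (ha : ∀ i, 0 < a i) (hab : ∀ i, a i ≤ b i) :
    ellipsoid n a ⊆ ellipsoid n b := by
  intro z hz
  refine lt_of_le_of_lt (show ellQ n b z ≤ ellQ n a z from Finset.sum_le_sum fun i _ => ?_) hz
  have := ha i
  have := hab i
  gcongr

theorem ellipsoid_subset_ball {R : ℝ} (ha : ∀ i, 0 < a i) (haR : ∀ i, a i ≤ R) (hR : 0 < R) :
    ellipsoid n a ⊆ ball 0 R := by
  intro z hz
  have hz' : ellQ n (fun _ => R) z < 1 := ellipsoid_subset_ellipsoid ha haR hz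
  rw [ellQ, ← Finset.sum_div, ← norm_sq_eq_sum_pairs, div_lt_one (by positivity)] at hz'
  rw [mem_ball_zero_iff]
  exact lt_of_pow_lt_pow_left₀ 2 hR.le hz'

theorem volume_real_ellShell_le {R ε : ℝ} (ha : ∀ i, 0 < a i) (haR : ∀ i, a i ≤ R) (hR : 0 < R)
    (hε : ε ∈ Ioo (0 : ℝ) 1) :
    volume.real (ellShell n a ε) ≤
      ((1 + ε) ^ (2 * n) - (1 - ε) ^ (2 * n)) * volume.real (ball (0 : R2n n) R) := by
  obtain ⟨hε0, hε1⟩ := hε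
  have h1 : 0 < 1 - ε := by linarith
  have h2 : 0 < 1 + ε := by linarith
  have hfin : ∀ c : ℝ, 0 < c → volume (ellipsoid n fun i => c * a i) ≠ ⊤ := fun c hc =>
    ((measure_mono (ellipsoid_subset_ball (fun i => mul_pos hc (ha i))
      (fun i => mul_le_mul_of_nonneg_left (haR i) hc.le) (mul_pos hc hR))).trans_lt
      measure_ball_lt_top).ne
  have hsub : ellipsoid n (fun i => (1 - ε) * a i) ⊆ ellipsoid n (fun i => (1 + ε) * a i) :=
    ellipsoid_subset_ellipsoid (fun i => mul_pos h1 (ha i))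
      fun i => mul_le_mul_of_nonneg_right (by linarith) (ha i).le
  calc volume.real (ellShell n a ε)
      ≤ volume.real (ellipsoid n (fun i => (1 + ε) * a i) \
          ellipsoid n (fun i => (1 - ε) * a i)) :=
        measureReal_mono (sdiff_subset_sdiff_right subset_closure)
          (measure_ne_top_of_subset sdiff_subset (hfin _ h2))
    _ = ((1 + ε) ^ (2 * n) - (1 - ε) ^ (2 * n)) * volume.real (ellipsoid n a) := by
        rw [measureReal_sdiff hsub (isOpen_ellipsoid _ _).measurableSet (hfin _ h2),
          volume_real_ellipsoid_const_mul h1, volume_real_ellipsoid_const_mul h2, sub_mul]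
    _ ≤ _ := by
        refine mul_le_mul_of_nonneg_left
          (measureReal_mono (ellipsoid_subset_ball ha haR hR) measure_ball_lt_top.ne) ?_
        exact sub_nonneg.2 (pow_le_pow_left₀ h1.le (by linarith) _)

end Ellipsoid

/-- An open bounded set `D` whose closure lies in a bounded open set `U` has smaller volume. -/
theorem volume_real_lt_of_closure_subset {V : Type*} [NormedAddCommGroup V] [InnerProductSpace ℝ V]
    [FiniteDimensional ℝ V] [Nontrivial V] [MeasurableSpace V] [BorelSpace V] {D U : Set V}
    (hU : IsOpen U) (hUb : IsBounded U) (hUne : U.Nonempty) (hDU : closure D ⊆ U) :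
    volume.real D < volume.real U := by
  have hne : (U \ closure D).Nonempty := by
    rw [sdiff_nonempty]
    intro h
    exact not_isClopen_of_isBounded hUne hUb ⟨(hDU.antisymm h) ▸ isClosed_closure, hU⟩
  have hopen : IsOpen (U \ closure D) := hU.sdiff isClosed_closure
  have hUfin : volume U ≠ ⊤ := hUb.measure_lt_top.ne
  have hcl : volume (closure D) ≠ ⊤ := measure_ne_top_of_subset hDU hUfin
  have hpos : 0 < volume.real (U \ closure D) :=
    ENNReal.toReal_pos (hopen.measure_pos _ hne).ne' (measure_ne_top_of_subset sdiff_subset hUfin)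
  rw [measureReal_sdiff hDU isClosed_closure.measurableSet hUfin] at hpos
  have := measureReal_mono (μ := volume) (subset_closure (s := D)) hcl
  linarith

/-- If `φ` is a symplectic embedding of a neighbourhood of `S_r^(2n-1)` into the shell
`U_ε` and the bounded connected component `D` of the complement of `φ(S_r^(2n-1))` is
contained in `U_ε`, then `πr² < ((1+ε)^(2n) - (1-ε)^(2n))^(1/n) · πR²`. -/
theorem volume_bound_of_component_in_shell
    (n : ℕ) (hn : 2 ≤ n) (a : Fin n → ℝ) (R : ℝ)
    (hmono : Monotone a) (hfirst : a ⟨0, by omega⟩ = 1) (hlast : a ⟨n - 1, by omega⟩ = R)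
    (ε : ℝ) (hε : ε ∈ Ioo (0 : ℝ) 1) (r : ℝ) (hr : 0 < r)
    (N : Set (R2n n)) (φ : R2n n → R2n n)
    (hN : sphere (0 : R2n n) r ⊆ N)
    (hφ : IsSympEmbOn n N (ellShell n a ε) φ)
    (D : Set (R2n n)) (x : R2n n)
    (hx : x ∈ (φ '' sphere (0 : R2n n) r)ᶜ)
    (hD : D = connectedComponentIn (φ '' sphere (0 : R2n n) r)ᶜ x)
    (hbd : IsBounded D)
    (hsub : D ⊆ ellShell n a ε) :
    π * r ^ 2 <
      (((1 + ε) ^ (2 * n) - (1 - ε) ^ (2 * n)) ^ ((1 : ℝ) / (n : ℝ))) * (π * R ^ 2) := by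
  obtain ⟨hNo, hφs, hφi, hφm, hφω⟩ := hφ
  have hapos : ∀ i, 0 < a i := fun i =>
    one_pos.trans_le (hfirst ▸ hmono (Fin.mk_le_of_le_val (Nat.zero_le _)))
  have haR : ∀ i, a i ≤ R := fun i => hlast ▸ hmono (Fin.mk_le_mk.2 (by have := i.isLt; omega))
  have hR : 0 < R := hlast ▸ hapos _
  have hfinrank : Module.finrank ℝ (R2n n) = 2 * n := finrank_euclideanSpace_fin
  have hdim : 2 < Module.finrank ℝ (R2n n) := by omega
  have : Nontrivial (R2n n) := Module.nontrivial_of_finrank_pos (R := ℝ) (by omega)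
  subst hD
  have hball := (isOrthoComplexStructure_std n).volume_real_ball_le hdim hr hNo hN hφs hφi
    (fun p hp v w => by
      rw [← sympForm_eq_inner, ← sympForm_eq_inner]
      exact hφω p hp v w) hx hbd
  have hF : IsClosed (φ '' sphere (0 : R2n n) r) :=
    ((isCompact_sphere _ _).image_of_continuousOn (hφs.continuousOn.mono hN)).isClosed
  have hFU : φ '' sphere (0 : R2n n) r ⊆ ellShell n a ε := (hφm.mono_left hN).image_subset
  have hUopen : IsOpen (ellShell n a ε) := (isOpen_ellipsoid _ _).sdiff isClosed_closure
  have h1ε : 0 < 1 + ε := by linarith [hε.1]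
  have hUb : IsBounded (ellShell n a ε) :=
    isBounded_ball.subset (sdiff_subset.trans (ellipsoid_subset_ball
      (fun i => mul_pos h1ε (hapos i)) (fun i => mul_le_mul_of_nonneg_left (haR i) h1ε.le)
      (mul_pos h1ε hR)))
  have hlt := volume_real_lt_of_closure_subset hUopen hUb
    (((NormedSpace.sphere_nonempty (x := (0 : R2n n))).2 hr.le).image φ |>.mono hFU)
    ((closure_connectedComponentIn_subset hF x).trans (union_subset hsub hFU))
  have hmain := (hball.trans_lt hlt).trans_le (volume_real_ellShell_le hapos haR hR hε)
  rw [volume_real_ball_eq hr, volume_real_ball_eq hR, hfinrank, ← mul_assoc] at hmain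
  have hpow := lt_of_mul_lt_mul_right hmain measureReal_nonneg
  have hc : 0 ≤ (1 + ε) ^ (2 * n) - (1 - ε) ^ (2 * n) :=
    sub_nonneg.2 (pow_le_pow_left₀ (by linarith [hε.2]) (by linarith [hε.1]) _)
  generalize (1 + ε) ^ (2 * n) - (1 - ε) ^ (2 * n) = c at hpow hc ⊢
  rw [mul_left_comm]
  refine mul_lt_mul_of_pos_left (lt_of_pow_lt_pow_left₀ n (by positivity) ?_) pi_pos
  rwa [mul_pow, one_div, Real.rpow_inv_natCast_pow hc (by omega), ← pow_mul, ← pow_mul]
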